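/- Let ζ ∈ C_c^∞(ℝ) and let L : ℝ → B be a map into a Banach space B that is twice continuously differentiable on supp ζ with sup_{ν ∈ supp ζ} ‖∂_ν^k L(ν)‖ < ∞ for k = 0,1,2. Fix ν₀ with ζ ≡ 1 near ν₀ and set Q(ν) = (L(ν) - L(ν₀))/(ν - ν₀) (extended by L'(ν₀) at ν = ν₀). Then K(t) = ∫ ζ(ν) e^{iνt} Q(ν) dν satisfies ‖K(t)‖ = O(t^{-3/2}) as t → ∞. -/

import Mathlib

open Real MeasureTheory Filter Topology

/-- The closure of an open subset of the line is a set of unique differentiability. -/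
theorem uniqueDiffOn_closure_of_isOpen {U : Set ℝ} (hU : IsOpen U) :
    UniqueDiffOn ℝ (closure U) := fun x hx =>
  (hU.perfect_closure.acc x hx).uniqueDiffWithinAt

section Extension

open Set

variable {E : Type*} [NormedAddCommGroup E] [NormedSpace ℝ E]

theorem deriv_eq_zero_of_notMem_of_isClosed {s : Set ℝ} (hs : IsClosed s) {u : ℝ → ℝ}
    (hu0 : ∀ x ∉ s, u x = 0) (x : ℝ) (hx : x ∉ s) : deriv u x = 0 := by
  have : u =ᶠ[𝓝 x] fun _ => 0 :=
    Filter.mem_of_superset (hs.isOpen_compl.mem_nhds hx) hu0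
  rw [this.deriv_eq, deriv_const]

theorem eq_zero_of_mem_closure_compl {s : Set ℝ} {u : ℝ → ℝ} (hu : Continuous u)
    (hu0 : ∀ x ∉ s, u x = 0) (x : ℝ) (hx : x ∈ closure sᶜ) : u x = 0 :=
  closure_minimal (t := {y | u y = 0}) hu0 (isClosed_eq hu continuous_const) hx

/-- Multiplying by a continuous function which vanishes off a closed set `s` extends a function
which is continuous on `s` to a continuous function. -/
theorem ContinuousOn.continuous_smul_of_eq_zero {s : Set ℝ} (hs : IsClosed s) {u : ℝ → ℝ}
    (hu : Continuous u) (hu0 : ∀ x ∉ s, u x = 0) {w : ℝ → E} (hw : ContinuousOn w s) :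
    Continuous fun x => u x • w x := by
  have hzero := eq_zero_of_mem_closure_compl hu hu0
  have h1 : ContinuousOn (fun x => u x • w x) s := hu.continuousOn.smul hw
  have h2 : ContinuousOn (fun x => u x • w x) (closure sᶜ) :=
    (continuousOn_const (c := (0 : E))).congr fun x hx => by simp [hzero x hx]
  rw [← continuousOn_univ]
  refine (h1.union_of_isClosed h2 hs isClosed_closure).mono fun x _ => ?_
  by_cases hx : x ∈ s
  · exact Or.inl hx
  · exact Or.inr (subset_closure hx)

theorem HasDerivWithinAt.hasDerivAt_smul_of_eq_zero {s : Set ℝ} (hs : IsClosed s) {u : ℝ → ℝ}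
    (hu : ContDiff ℝ 1 u) (hu0 : ∀ x ∉ s, u x = 0) {w w' : ℝ → E}
    (hw : ∀ x ∈ s, HasDerivWithinAt w (w' x) s x) (x : ℝ) :
    HasDerivAt (fun x => u x • w x) (deriv u x • w x + u x • w' x) x := by
  have hd0 := deriv_eq_zero_of_notMem_of_isClosed hs hu0
  have hzero := eq_zero_of_mem_closure_compl hu.continuous hu0
  have hdzero := eq_zero_of_mem_closure_compl (hu.continuous_deriv le_rfl) hd0
  have hudiff : HasDerivAt u (deriv u x) x :=
    (hu.differentiable one_ne_zero x).hasDerivAt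
  have h1 : HasDerivWithinAt (fun x => u x • w x) (deriv u x • w x + u x • w' x) s x := by
    by_cases hx : x ∈ s
    · rw [add_comm]
      exact hudiff.hasDerivWithinAt.smul (hw x hx)
    · exact HasFDerivWithinAt.of_notMem_closure (by rwa [hs.closure_eq])
  have h2 : HasDerivWithinAt (fun x => u x • w x) (deriv u x • w x + u x • w' x) sᶜ x := by
    by_cases hx : x ∈ closure sᶜ
    · rw [hzero x hx, hdzero x hx, zero_smul, zero_smul, add_zero]
      exact (hasDerivWithinAt_const x sᶜ (0 : E)).congr (fun y hy => by simp [hu0 y hy])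
        (by simp [hzero x hx])
    · exact HasFDerivWithinAt.of_notMem_closure hx
  simpa using h1.union h2

/-- Multiplying by a smooth function which vanishes off a closed set `s` extends a function
which is `C^n` on `s` to a `C^n` function. -/
theorem ContDiffOn.contDiff_smul_of_eq_zero {s : Set ℝ} (hs : IsClosed s)
    (hsd : UniqueDiffOn ℝ s) (n : ℕ) {u : ℝ → ℝ} (hu : ContDiff ℝ (⊤ : ℕ∞) u)
    (hu0 : ∀ x ∉ s, u x = 0) {w : ℝ → E} (hw : ContDiffOn ℝ n w s) :
    ContDiff ℝ n fun x => u x • w x := by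
  induction n generalizing u w with
  | zero =>
    exact contDiff_zero.2 (hw.continuousOn.continuous_smul_of_eq_zero hs hu.continuous hu0)
  | succ n ih =>
    have hw1 := hw
    push_cast at hw1 ⊢
    rw [contDiffOn_succ_iff_derivWithin hsd] at hw1
    have hder := HasDerivWithinAt.hasDerivAt_smul_of_eq_zero hs (hu.of_le (by exact_mod_cast le_top))
      hu0 (fun x hx => (hw1.1 x hx).hasDerivWithinAt)
    have hdu : ContDiff ℝ (⊤ : ℕ∞) (deriv u) := (contDiff_infty_iff_deriv.1 hu).2
    have hd0 := deriv_eq_zero_of_notMem_of_isClosed hs hu0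
    rw [contDiff_succ_iff_deriv]
    refine ⟨fun x => (hder x).differentiableAt, by simp, ?_⟩
    rw [funext fun x => (hder x).deriv]
    exact (ih hdu hd0 (hw.of_le (by exact_mod_cast n.le_succ))).add (ih hu hu0 hw1.2.2)

theorem HasDerivAt.inv_sub_smul {g : ℝ → E} {g' : E} {a x : ℝ} (hg : HasDerivAt g g' x)
    (hx : x ≠ a) :
    HasDerivAt (fun y => (y - a)⁻¹ • g y) ((x - a)⁻¹ • (g' - (x - a)⁻¹ • g x)) x := by
  have hxa : x - a ≠ 0 := sub_ne_zero.2 hx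
  convert (((hasDerivAt_id x).sub_const a).inv hxa).smul hg using 1
  · rfl
  change _ = (x - a)⁻¹ • g' + (-1 / (x - a) ^ 2) • g x
  simp only [smul_sub, smul_smul]
  rw [sub_eq_add_neg, ← neg_smul]
  congr 2
  field_simp

theorem norm_deriv_sub_dslope_le {h : ℝ → E} (hh : ContDiff ℝ 2 h) {M : ℝ}
    (hM : ∀ x, ‖deriv (deriv h) x‖ ≤ M) (a x : ℝ) :
    ‖deriv h x - dslope h a x‖ ≤ M * |x - a| := by
  have hd1 : Differentiable ℝ h := hh.differentiable two_ne_zero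
  have hd2 : Differentiable ℝ (deriv h) :=
    ((contDiff_succ_iff_deriv (n := 1)).1 hh).2.2.differentiable one_ne_zero
  rcases eq_or_ne x a with rfl | hxa
  · simp
  have hlip : ∀ y ∈ uIcc a x, ‖deriv h y - deriv h x‖ ≤ M * |x - a| := fun y hy => by
    have h1 := convex_univ.norm_image_sub_le_of_norm_hasDerivWithin_le (f := deriv h)
      (fun z _ => (hd2 z).hasDerivAt.hasDerivWithinAt) (fun z _ => hM z) (mem_univ x) (mem_univ y)
    refine h1.trans (mul_le_mul_of_nonneg_left ?_ ((norm_nonneg _).trans (hM x)))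
    rw [Real.norm_eq_abs, abs_sub_comm y x]
    exact abs_sub_right_of_mem_uIcc hy
  have h2 := (convex_uIcc a x).norm_image_sub_le_of_norm_hasDerivWithin_le
    (f := fun y => h y - (y - a) • deriv h x) (f' := fun y => deriv h y - deriv h x)
    (fun y _ => by
      have := (hd1 y).hasDerivAt.sub (((hasDerivAt_id y).sub_const a).smul_const (deriv h x))
      rw [one_smul] at this
      exact this.hasDerivWithinAt)
    hlip left_mem_uIcc right_mem_uIcc
  have hpos : 0 < |x - a| := abs_pos.2 (sub_ne_zero.2 hxa)
  rw [← mul_le_mul_iff_left₀ hpos]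
  refine le_trans (le_of_eq ?_) h2
  rw [dslope_of_ne _ hxa, slope_def_module, mul_comm, ← Real.norm_eq_abs, ← norm_smul,
    smul_sub, smul_inv_smul₀ (sub_ne_zero.2 hxa), ← norm_neg]
  congr 1
  simp
  abel

end Extension

section Oscillatory

open Set

variable {B : Type*} [NormedAddCommGroup B] [NormedSpace ℂ B]

theorem norm_exp_I_mul_smul (x t : ℝ) (v : B) :
    ‖Complex.exp (Complex.I * x * t) • v‖ = ‖v‖ := by
  rw [norm_smul, show Complex.I * x * t = ((x * t : ℝ) : ℂ) * Complex.I by push_cast; ring,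
    Complex.norm_exp_ofReal_mul_I, one_mul]

variable [CompleteSpace B]

theorem integral_exp_smul_eq_of_hasDerivAt_off_countable {f f' : ℝ → B} {S : Set ℝ}
    (hS : S.Countable) {a b t : ℝ} (hab : a ≤ b) (ht : t ≠ 0) (hf : ContinuousOn f (Icc a b))
    (hf' : ∀ x ∈ Ioo a b \ S, HasDerivAt f (f' x) x) (hi : IntervalIntegrable f' volume a b) :
    ∫ x in a..b, Complex.exp (Complex.I * x * t) • f x =
      (Complex.I * t)⁻¹ • (Complex.exp (Complex.I * b * t) • f b -
        Complex.exp (Complex.I * a * t) • f a -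
          ∫ x in a..b, Complex.exp (Complex.I * x * t) • f' x) := by
  have hIt : Complex.I * t ≠ 0 := mul_ne_zero Complex.I_ne_zero (by exact_mod_cast ht)
  have he : ∀ x : ℝ, HasDerivAt (fun x : ℝ => Complex.exp (Complex.I * x * t))
      ((Complex.I * t) * Complex.exp (Complex.I * x * t)) x := fun x => by
    have h1 : HasDerivAt (fun x : ℝ => Complex.I * x * t) (Complex.I * t) x := by
      simpa using ((Complex.ofRealCLM.hasDerivAt (x := x)).const_mul Complex.I).mul_const (t : ℂ)
    simpa [mul_comm] using h1.cexp
  have hc : Continuous fun x : ℝ => Complex.exp (Complex.I * x * t) := by fun_prop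
  have hi1 : IntervalIntegrable (fun x : ℝ => Complex.exp (Complex.I * x * t) • f x)
      volume a b :=
    ContinuousOn.intervalIntegrable (by rw [uIcc_of_le hab]; exact hc.continuousOn.smul hf)
  have hi2 : IntervalIntegrable (fun x : ℝ => Complex.exp (Complex.I * x * t) • f' x)
      volume a b := hi.continuousOn_smul hc.continuousOn
  have key := MeasureTheory.integral_eq_of_hasDerivAt_off_countable_of_le
    (fun x : ℝ => Complex.exp (Complex.I * x * t) • f x)
    (fun x : ℝ => (Complex.I * t) • (Complex.exp (Complex.I * x * t) • f x) +
      Complex.exp (Complex.I * x * t) • f' x)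
    hab hS (hc.continuousOn.smul hf)
    (fun x hx => by
      rw [smul_smul, add_comm]
      exact (he x).smul (hf' x hx))
    ((hi1.smul _).add hi2)
  rw [intervalIntegral.integral_add (by exact hi1.smul _) hi2, intervalIntegral.integral_smul] at key
  rw [← key, add_sub_cancel_right, inv_smul_smul₀ hIt]

theorem norm_integral_exp_smul_le {f f' : ℝ → B} {a b t M N : ℝ} (hab : a ≤ b) (ht : 0 < t)
    (hf : ∀ x ∈ Icc a b, HasDerivAt f (f' x) x) (hi : ContinuousOn f' (Icc a b))
    (hM : ∀ x ∈ Icc a b, ‖f x‖ ≤ M) (hN : ∀ x ∈ Icc a b, ‖f' x‖ ≤ N) :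
    ‖∫ x in a..b, Complex.exp (Complex.I * x * t) • f x‖ ≤ (2 * M + N * (b - a)) / t := by
  rw [integral_exp_smul_eq_of_hasDerivAt_off_countable countable_empty hab ht.ne'
    (fun x hx => (hf x hx).continuousAt.continuousWithinAt)
    (fun x hx => hf x (Ioo_subset_Icc_self hx.1))
    (ContinuousOn.intervalIntegrable (by rwa [uIcc_of_le hab]))]
  rw [norm_smul, norm_inv, norm_mul, Complex.norm_I, one_mul, Complex.norm_real,
    Real.norm_of_nonneg ht.le, div_eq_inv_mul]
  refine mul_le_mul_of_nonneg_left ?_ (inv_nonneg.2 ht.le)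
  have h1 : ‖∫ x in a..b, Complex.exp (Complex.I * x * t) • f' x‖ ≤ N * |b - a| :=
    intervalIntegral.norm_integral_le_of_norm_le_const fun x hx => by
      rw [norm_exp_I_mul_smul]
      rw [uIoc_of_le hab] at hx
      exact hN x (Ioc_subset_Icc_self hx)
  rw [abs_of_nonneg (sub_nonneg.2 hab)] at h1
  have h2 := norm_sub_le (Complex.exp (Complex.I * b * t) • f b)
    (Complex.exp (Complex.I * a * t) • f a)
  rw [norm_exp_I_mul_smul, norm_exp_I_mul_smul] at h2
  have h3 := norm_sub_le (Complex.exp (Complex.I * b * t) • f b -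
    Complex.exp (Complex.I * a * t) • f a) (∫ x in a..b, Complex.exp (Complex.I * x * t) • f' x)
  linarith [hM a (left_mem_Icc.2 hab), hM b (right_mem_Icc.2 hab)]

/-- Decay of the oscillatory integral of the difference quotient at one of its zeros of a compactly
supported `C²` function. -/
theorem exists_norm_integral_exp_smul_dslope_le {h : ℝ → B} (hh : ContDiff ℝ 2 h)
    (hc : HasCompactSupport h) {a : ℝ} (ha : h a = 0) :
    ∃ C : ℝ, ∀ t : ℝ, 1 ≤ t →
      ‖∫ x : ℝ, Complex.exp (Complex.I * x * t) • dslope h a x‖ ≤ C * t ^ (-(3/2) : ℝ) := by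
  have hh1 : ContDiff ℝ 1 (deriv h) := ((contDiff_succ_iff_deriv (n := 1)).1 hh).2.2
  have hd1 : Differentiable ℝ h := hh.differentiable two_ne_zero
  have hd2 : Differentiable ℝ (deriv h) := hh1.differentiable one_ne_zero
  have hcont2 : Continuous (deriv (deriv h)) := hh1.continuous_deriv le_rfl
  obtain ⟨M, hM⟩ := hcont2.bounded_above_of_compact_support hc.deriv.deriv
  have hM0 : 0 ≤ M := (norm_nonneg _).trans (hM 0)
  obtain ⟨R, hR1, hR⟩ : ∃ R : ℝ, 1 < R ∧ tsupport h ⊆ Metric.ball a R := by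
    obtain ⟨R, hR⟩ := hc.isCompact.isBounded.subset_ball a
    exact ⟨max R 2, by simp, hR.trans (Metric.ball_subset_ball (le_max_left _ _))⟩
  have hsupp : ∀ x, R ≤ |x - a| → dslope h a x = 0 := fun x hx => by
    have hxa : x ≠ a := by
      rintro rfl
      simp at hx
      linarith
    have : h x = 0 := by
      refine image_eq_zero_of_notMem_tsupport fun hmem => ?_
      have := hR hmem
      rw [Metric.mem_ball, Real.dist_eq] at this
      linarith
    rw [dslope_of_ne _ hxa, slope_def_module, this, ha, sub_zero, smul_zero]
  have hq : Continuous (dslope h a) := by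
    rw [← continuousOn_univ, continuousOn_dslope univ_mem]
    exact ⟨hd1.continuous.continuousOn, hd1 a⟩
  set p : ℝ → B := fun x => (x - a)⁻¹ • (deriv h x - dslope h a x) with hp
  have hqp : ∀ x, x ≠ a → HasDerivAt (dslope h a) (p x) x := fun x hx => by
    have h1 := ((hd1 x).hasDerivAt.sub_const (h a)).inv_sub_smul hx
    have h2 : dslope h a =ᶠ[𝓝 x] fun y => (y - a)⁻¹ • (h y - h a) := by
      filter_upwards [isOpen_ne.mem_nhds hx] with y hy
      rw [dslope_of_ne _ hy, slope_def_module]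
    have h3 := h1.congr_of_eventuallyEq h2
    simpa only [hp, h2.eq_of_nhds] using h3
  have hpM : ∀ x, ‖p x‖ ≤ M := fun x => by
    rcases eq_or_ne x a with rfl | hxa
    · simpa [hp] using hM0
    · have hpos : 0 < |x - a| := abs_pos.2 (sub_ne_zero.2 hxa)
      rw [hp, norm_smul, norm_inv, Real.norm_eq_abs, inv_mul_le_iff₀ hpos, mul_comm]
      exact norm_deriv_sub_dslope_le hh hM a x
  have hpp : ∀ x, x ≠ a → HasDerivAt p ((x - a)⁻¹ • (deriv (deriv h) x - p x - p x)) x :=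
    fun x hx => ((hd2 x).hasDerivAt.sub (hqp x hx)).inv_sub_smul hx
  have hpmeas : AEStronglyMeasurable p volume :=
    ((measurable_id.sub_const a).inv).aestronglyMeasurable.smul
      (hh1.continuous.sub hq).aestronglyMeasurable
  have hpint : ∀ c d, IntervalIntegrable p volume c d := fun c d =>
    (intervalIntegrable_const (c := M)).mono_fun hpmeas.restrict
      (ae_of_all _ fun x => (hpM x).trans (le_abs_self M))
  have houter : ∀ {t δ c d : ℝ}, 0 < t → 0 < δ → c ≤ d → d - c ≤ R →
      (∀ x ∈ Icc c d, δ ≤ |x - a|) →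
      ‖∫ x in c..d, Complex.exp (Complex.I * x * t) • p x‖ ≤ (2 * M + 3 * M / δ * R) / t := by
    intro t δ c d ht hδ hcd hdc hδx
    have hne : ∀ x ∈ Icc c d, x ≠ a := fun x hx hxa => by
      have := hδx x hx
      rw [hxa, sub_self, abs_zero] at this
      linarith
    refine (norm_integral_exp_smul_le hcd ht (fun x hx => hpp x (hne x hx)) ?_
      (fun x _ => hpM x) (N := 3 * M / δ) fun x hx => ?_).trans ?_
    · have hpc : ContinuousOn p (Icc c d) := fun x hx =>
        (hpp x (hne x hx)).continuousAt.continuousWithinAt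
      exact ((continuousOn_id.sub continuousOn_const).inv₀
        fun x hx => sub_ne_zero.2 (hne x hx)).smul ((hcont2.continuousOn.sub hpc).sub hpc)
    · rw [norm_smul, norm_inv, Real.norm_eq_abs, div_eq_inv_mul]
      refine mul_le_mul (inv_anti₀ hδ (hδx x hx)) ?_ (norm_nonneg _) (inv_nonneg.2 hδ.le)
      have h1 := norm_sub_le (deriv (deriv h) x - p x) (p x)
      have h2 := norm_sub_le (deriv (deriv h) x) (p x)
      linarith [hM x, hpM x]
    · gcongr
  refine ⟨6 * M + 6 * M * R, fun t ht => ?_⟩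
  have ht0 : 0 < t := by linarith
  have hwhole : ∫ x : ℝ, Complex.exp (Complex.I * x * t) • dslope h a x =
      ∫ x in (a - R)..(a + R), Complex.exp (Complex.I * x * t) • dslope h a x := by
    refine (intervalIntegral.integral_eq_integral_of_support_subset fun x hx => ?_).symm
    by_contra hmem
    refine hx ?_
    simp only
    rw [hsupp x, smul_zero]
    by_contra! hlt
    rw [abs_lt] at hlt
    exact hmem ⟨by linarith, by linarith⟩
  have hibp := integral_exp_smul_eq_of_hasDerivAt_off_countable (countable_singleton a)
    (a := a - R) (b := a + R) (by linarith) ht0.ne' hq.continuousOn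
    (fun x hx => hqp x hx.2) (hpint _ _)
  rw [hsupp (a - R) (by simpa using le_abs_self R), hsupp (a + R) (by simpa using le_abs_self R),
    smul_zero, smul_zero, sub_zero, zero_sub] at hibp
  set δ : ℝ := (√t)⁻¹ with hδ
  have hst : 1 ≤ √t := Real.one_le_sqrt.2 ht
  have hst0 : 0 < √t := by linarith
  have hδ0 : 0 < δ := inv_pos.2 hst0
  have hδ1 : δ ≤ 1 := inv_le_one_of_one_le₀ hst
  have hepi : ∀ c d, IntervalIntegrable (fun x : ℝ => Complex.exp (Complex.I * x * t) • p x)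
      volume c d := fun c d =>
    (hpint c d).continuousOn_smul (Continuous.continuousOn (by fun_prop))
  have hleft := houter (t := t) (c := a - R) (d := a - δ) ht0 hδ0 (by linarith) (by linarith)
    fun x hx => by
      rw [abs_sub_comm]
      exact le_trans (by linarith [hx.2]) (le_abs_self _)
  have hright := houter (t := t) (c := a + δ) (d := a + R) ht0 hδ0 (by linarith) (by linarith)
    fun x hx => le_trans (by linarith [hx.1]) (le_abs_self _)
  have hmid : ‖∫ x in (a - δ)..(a + δ), Complex.exp (Complex.I * x * t) • p x‖ ≤ M * (2 * δ) := by
    have := intervalIntegral.norm_integral_le_of_norm_le_const (a := a - δ) (b := a + δ)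
      (f := fun x : ℝ => Complex.exp (Complex.I * x * t) • p x) (C := M)
      fun x _ => (norm_exp_I_mul_smul x t (p x)).trans_le (hpM x)
    rwa [show a + δ - (a - δ) = 2 * δ by ring, abs_of_pos (by linarith)] at this
  have hsplit := intervalIntegral.integral_add_adjacent_intervals
    (hepi (a - R) (a - δ)) (hepi (a - δ) (a + δ))
  have hsplit2 := intervalIntegral.integral_add_adjacent_intervals
    (hepi (a - R) (a + δ)) (hepi (a + δ) (a + R))
  have hrpow : t ^ (-(3/2) : ℝ) = t⁻¹ * δ := by
    rw [hδ, Real.sqrt_eq_rpow, ← Real.rpow_neg ht0.le, ← Real.rpow_neg_one,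
      ← Real.rpow_add ht0]
    norm_num
  have htδ : t⁻¹ = δ * δ := by
    rw [hδ, ← mul_inv, Real.mul_self_sqrt ht0.le]
  have hsingle : (2 * M + 3 * M / δ * R) / t ≤ (2 * M + 3 * M * R) * δ := by
    rw [div_eq_mul_inv, htδ]
    have h1 : (2 * M + 3 * M / δ * R) * (δ * δ) = (2 * M * δ + 3 * M * R) * δ := by
      field_simp
    rw [h1]
    refine mul_le_mul_of_nonneg_right ?_ hδ0.le
    nlinarith
  rw [hwhole, hibp, norm_smul, norm_neg, norm_inv, norm_mul, Complex.norm_I, one_mul,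
    Complex.norm_real, Real.norm_of_nonneg ht0.le, hrpow, mul_left_comm]
  refine mul_le_mul_of_nonneg_left ?_ (inv_nonneg.2 ht0.le)
  rw [← hsplit2, ← hsplit]
  refine (norm_add₃_le).trans ?_
  linarith

end Oscillatory

/-- for `ζ ∈ C_c^∞(ℝ)` with `ζ ≡ 1` near `ν₀`, and `L : ℝ → B`
twice continuously differentiable on `supp ζ` with bounded derivatives there,
the difference-quotient oscillatory integral
`K(t) = ∫ ζ(ν) e^{iνt} Q(ν) dν`, `Q(ν) = (L(ν)-L(ν₀))/(ν-ν₀)`,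
satisfies `‖K(t)‖ = O(t^{-3/2})` as `t → ∞`. -/
theorem difference_quotient_oscillatory_decay
    {B : Type*} [NormedAddCommGroup B] [NormedSpace ℂ B] [CompleteSpace B]
    (ζ : ℝ → ℝ) (hζ : ContDiff ℝ (⊤ : ℕ∞) ζ) (hζc : HasCompactSupport ζ)
    (ν₀ : ℝ) (hone : ∀ᶠ ν in 𝓝 ν₀, ζ ν = 1)
    (L : ℝ → B) (hL : ContDiffOn ℝ 2 L (tsupport ζ))
    (hbd : ∀ k : ℕ, k ≤ 2 → ∃ M : ℝ, ∀ ν ∈ tsupport ζ,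
      ‖iteratedDerivWithin k L (tsupport ζ) ν‖ ≤ M) :
    let Q : ℝ → B := fun ν =>
      if ν = ν₀ then derivWithin L (tsupport ζ) ν₀
      else ((ν - ν₀ : ℂ))⁻¹ • (L ν - L ν₀)
    let K : ℝ → B := fun t => ∫ ν : ℝ, ((ζ ν : ℂ) * Complex.exp (Complex.I * ν * t)) • Q ν
    ∃ C : ℝ, ∀ t : ℝ, 1 ≤ t → ‖K t‖ ≤ C * t ^ (-(3/2) : ℝ) := by
  intro Q K
  have hsd : UniqueDiffOn ℝ (tsupport ζ) :=
    uniqueDiffOn_closure_of_isOpen hζ.continuous.isOpen_support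
  set h : ℝ → B := fun ν => ζ ν • (L ν - L ν₀) with hh
  have hC : ContDiff ℝ 2 h :=
    ContDiffOn.contDiff_smul_of_eq_zero (isClosed_tsupport ζ) hsd 2 hζ
      (fun _ hx => image_eq_zero_of_notMem_tsupport hx) (hL.sub contDiffOn_const)
  have h0 : h ν₀ = 0 := by simp [hh]
  obtain ⟨C, hbound⟩ := exists_norm_integral_exp_smul_dslope_le hC hζc.smul_right h0
  refine ⟨C, fun t ht => ?_⟩
  have hKeq : K t = ∫ ν : ℝ, Complex.exp (Complex.I * ν * t) • dslope h ν₀ ν := by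
    refine integral_congr_ae ?_
    filter_upwards [compl_mem_ae_iff.2 (measure_singleton ν₀)] with ν hν
    have hne : ν ≠ ν₀ := hν
    have hQ : Q ν = ((ν - ν₀ : ℝ)⁻¹) • (L ν - L ν₀) := by
      simp only [Q, if_neg hne]
      rw [← Complex.coe_smul]
      push_cast
      rfl
    rw [dslope_of_ne _ hne, slope_def_module, h0, sub_zero, hQ, mul_comm, mul_smul,
      Complex.coe_smul, smul_comm (ζ ν)]
  rw [hKeq]
  exact hbound t ht
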